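/- Let N ≥ 0 and let a : ℝ → ℝ be of class C^{N+1} with a and all its derivatives up to order N+1 bounded and Lipschitz continuous, and with m ≤ a(x)/2 ≤ M for all x, for positive constants m, M. Fix y ∈ ℝ and set x̄ = y, α₀ := a(y), α_k := (1/2) a^{(k)}(y)/k! for 1 ≤ k ≤ N+1; let L := (a(x)/2)(∂_{xx} − ∂_x) + ∂_t and L_n := (α₀/2)(∂_{xx} − ∂_x) + ∂_t + Σ_{k=1}^{n} α_k (x−y)^k (∂_{xx} − ∂_x). Let G⁰ be the Gaussian (2πα₀(T−t))^{−1/2} exp(−(x−y−α₀(T−t)/2)²/(2α₀(T−t))), define G^n (1 ≤ n ≤ N) recursively by G^n(t,x;T,y) := Σ_{h=1}^{n} α_h ∫_t^T ∫_ℝ G⁰(t,x;s,η)(η−y)^h (∂_{ηη}−∂_η) G^{n−h}(s,η;T,y) dη ds, set Γ^N := Σ_{k=0}^N G^k, and define Z₀^N(t,x;T,y) := L Γ^N(t,x;T,y) and Z^N_{n+1}(t,x;T,y) := ∫_t^T ∫_ℝ L^{(t,x)} G⁰_η(t,x;s,η) Z^N_n(s,η;T,y) dη ds, where G⁰_η(t,x;s,η)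 denotes the Gaussian parametrix with basepoint frozen at η (i.e. with α₀ replaced by a(η)). Then for any ε > 0 and τ > 0 there exists C > 0, depending only on ε, τ, m, M, N and the bounds on a and its derivatives, such that for all n ≥ 0, x, y ∈ ℝ and 0 < T − t ≤ τ: | Z^N_n(t,x;T,y) | ≤ C^{n+1} ( Γ_E((1+N)/2) / Γ_E((n+1+N)/2) ) (T−t)^{(N+n−1)/2} Γ̄^{M+ε}(t,x;T,y), where Γ_E is the Euler Gamma function and Γ̄^{c}(t,x;T,y) := (4πc(T−t))^{−1/2} exp(−(x−y)²/(4c(T−t))). -/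

import Mathlib

open Filter Topology Set MeasureTheory intervalIntegral

noncomputable section

/-- The Gaussian fundamental solution of `L₀ = (c/2)(∂_{xx} - ∂_x) + ∂_t` :
`gaussK c t x v y = (2πc(v-t))^{-1/2} exp(-(x - y - c(v-t)/2)²/(2c(v-t)))`. -/
def gaussK (c : ℝ) (t x v y : ℝ) : ℝ :=
  (Real.sqrt (2 * Real.pi * (c * (v - t))))⁻¹ *
    Real.exp (-(x - y - c * (v - t) / 2)^2 / (2 * c * (v - t)))

/-- The Gaussian fundamental solution `Γ̄^c` of the heat operator `c∂_{xx} + ∂_t`. -/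
def heatKer (c : ℝ) (t x v y : ℝ) : ℝ :=
  (Real.sqrt (4 * Real.pi * c * (v - t)))⁻¹ *
    Real.exp (-(x - y)^2 / (4 * c * (v - t)))

/-- `L G⁰_η (t,x;s,η)`: the operator `L = (a(x)/2)(∂_{xx} - ∂_x) + ∂_t` applied to the
Gaussian parametrix with basepoint frozen at `η` (i.e. with diffusion coefficient `a(η)`). -/
def LG0 (a : ℝ → ℝ) (t x s η : ℝ) : ℝ :=
  (a x / 2) * (iteratedDeriv 2 (fun z => gaussK (a η) t z s η) x
      - deriv (fun z => gaussK (a η) t z s η) x)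
    + deriv (fun u => gaussK (a η) u x s η) t

/-- Centered Gaussian density with variance `v`. -/
def gd (v z : ℝ) : ℝ := (Real.sqrt (2 * Real.pi * v))⁻¹ * Real.exp (-z^2 / (2 * v))

/-- The Gaussian kernel in the variables `τ = T - t`, `ζ = x - y`. -/
def Gk (c τ ζ : ℝ) : ℝ := Real.exp (ζ / 2 - c * τ / 8) * gd (c * τ) ζ

lemma gaussK_eq {c t v : ℝ} (hc : 0 < c) (htv : t < v) (x y : ℝ) :
    gaussK c t x v y = Gk c (v - t) (x - y) := by
  unfold gaussK Gk gd
  have h1 : 0 < v - t := by linarith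
  generalize v - t = τ at *
  generalize x - y = ζ
  have : -(ζ - c * τ / 2)^2 / (2 * c * τ) = (ζ / 2 - c * τ / 8) + -ζ^2 / (2 * (c * τ)) := by
    field_simp
    ring
  rw [this, Real.exp_add]
  ring

lemma heatKer_eq (c t v x y : ℝ) :
    heatKer c t x v y = gd (2 * c * (v - t)) (x - y) := by
  unfold heatKer gd
  have h1 : 4 * Real.pi * c * (v - t) = 2 * Real.pi * (2 * c * (v - t)) := by ring
  have h2 : 4 * c * (v - t) = 2 * (2 * c * (v - t)) := by ring
  rw [h1, h2]

lemma gd_nonneg (v z : ℝ) : 0 ≤ gd v z := by unfold gd; positivity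

lemma gd_pdf {v : ℝ} (hv : 0 ≤ v) (μ z : ℝ) :
    gd v (z - μ) = ProbabilityTheory.gaussianPDFReal μ v.toNNReal z := by
  unfold gd ProbabilityTheory.gaussianPDFReal
  rw [Real.coe_toNNReal v hv]

lemma integral_gd {v : ℝ} (hv : 0 < v) (μ : ℝ) : ∫ z, gd v (z - μ) = 1 := by
  simp_rw [gd_pdf hv.le]
  apply ProbabilityTheory.integral_gaussianPDFReal_eq_one
  simpa using hv

lemma integrable_pow_gd0 {v : ℝ} (hv : 0 < v) (q : ℕ) : Integrable (fun z => z^q * gd v z) := by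
  have := (integrable_rpow_mul_exp_neg_mul_sq (b := 1 / (2 * v)) (by positivity)
    (s := q) (by have : (0:ℝ) ≤ q := by positivity
                 linarith)).const_mul (Real.sqrt (2 * Real.pi * v))⁻¹
  refine this.congr (ae_of_all _ fun z => ?_)
  simp only [Real.rpow_natCast, gd]
  have : -(1 / (2 * v)) * z ^ 2 = -z^2 / (2 * v) := by ring
  rw [this]; ring

lemma integrable_pow_gd {v : ℝ} (hv : 0 < v) (μ : ℝ) (q : ℕ) :
    Integrable (fun z => z^q * gd v (z - μ)) := by
  have h : Integrable (fun z => (z + μ)^q * gd v z) := by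
    simp_rw [add_pow, Finset.sum_mul]
    refine integrable_finsetSum _ fun k _ => ?_
    refine ((integrable_pow_gd0 hv k).const_mul (μ^(q-k) * (q.choose k))).congr
      (ae_of_all _ fun z => ?_)
    simp only []
    ring
  simpa using h.comp_sub_right μ

/-- Gaussian moments. -/
def He (μ v : ℝ) : ℕ → ℝ
  | 0 => 1
  | 1 => μ
  | (q + 2) => μ * He μ v (q + 1) + (q + 1) * v * He μ v q

lemma hasDerivAt_gd_z {v : ℝ} (hv : 0 < v) (z : ℝ) :
    HasDerivAt (fun z => gd v z) (gd v z * (-z / v)) z := by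
  unfold gd
  have h : HasDerivAt (fun z : ℝ => -z^2 / (2 * v)) (-z / v) z := by
    have := ((hasDerivAt_pow 2 z).neg).div_const (2 * v)
    refine this.congr_deriv ?_
    field_simp
    simp
  have := (h.exp).const_mul (Real.sqrt (2 * Real.pi * v))⁻¹
  refine this.congr_deriv ?_
  ring

lemma moment_rec {v : ℝ} (hv : 0 < v) (μ : ℝ) (q : ℕ) :
    ∫ z, z^(q+1) * gd v (z - μ) = μ * (∫ z, z^q * gd v (z - μ))
      + q * v * ∫ z, z^(q-1) * gd v (z - μ) := by
  have hd : ∀ z : ℝ, HasDerivAt (fun z => z^q * gd v (z - μ))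
      (q * (z^(q-1) * gd v (z - μ)) - (z^(q+1) * gd v (z - μ)) / v
        + μ / v * (z^q * gd v (z - μ))) z := by
    intro z
    have h1 := (hasDerivAt_gd_z hv (z - μ)).comp_sub_const z μ
    have h2 := (hasDerivAt_pow q z).mul h1
    refine h2.congr_deriv ?_
    field_simp
    ring
  have i1 := (integrable_pow_gd hv μ (q-1)).const_mul (q : ℝ)
  have i2 := (integrable_pow_gd hv μ (q+1)).div_const v
  have i3 := (integrable_pow_gd hv μ q).const_mul (μ / v)
  have key := integral_eq_zero_of_hasDerivAt_of_integrable hd ((i1.sub i2).add i3)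
    (integrable_pow_gd hv μ q)
  have e := integral_add (i1.sub i2) i3
  have e2 := integral_sub i1 i2
  simp only [Pi.sub_apply] at e
  rw [e, e2, MeasureTheory.integral_const_mul, MeasureTheory.integral_div, MeasureTheory.integral_const_mul] at key
  field_simp at key
  linarith

lemma moment {v : ℝ} (hv : 0 < v) (μ : ℝ) : ∀ q : ℕ, ∫ z, z^q * gd v (z - μ) = He μ v q
  | 0 => by simp [He, integral_gd hv]
  | 1 => by
    have := moment_rec hv μ 0
    simp [integral_gd hv] at this
    simpa [He] using this
  | (q + 2) => by
    have := moment_rec hv μ (q + 1)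
    rw [this, moment hv μ (q+1)]
    simp only [Nat.add_sub_cancel]
    rw [moment hv μ q]
    simp [He]

lemma gd_mul {v w : ℝ} (hv : 0 < v) (hw : 0 < w) (x η : ℝ) :
    gd v (x - η) * gd w η = gd (v + w) x * gd (v * w / (v + w)) (η - x * w / (v + w)) := by
  unfold gd
  have hvw : 0 < v + w := by positivity
  have e : -(x - η)^2 / (2 * v) + -η^2 / (2 * w) = -x^2 / (2 * (v + w)) +
      -(η - x * w / (v + w))^2 / (2 * (v * w / (v + w))) := by
    field_simp
    ring
  have s : (Real.sqrt (2 * Real.pi * v))⁻¹ * (Real.sqrt (2 * Real.pi * w))⁻¹ =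
     (Real.sqrt (2 * Real.pi * (v + w)))⁻¹ * (Real.sqrt (2 * Real.pi * (v * w / (v + w))))⁻¹ := by
    rw [← mul_inv, ← mul_inv, ← Real.sqrt_mul (by positivity), ← Real.sqrt_mul (by positivity)]
    congr 2
    field_simp
  calc _ = ((Real.sqrt (2 * Real.pi * v))⁻¹ * (Real.sqrt (2 * Real.pi * w))⁻¹) *
        Real.exp (-(x - η)^2 / (2 * v) + -η^2 / (2 * w)) := by rw [Real.exp_add]; ring
    _ = _ := by rw [e, s, Real.exp_add]; ring

lemma heat_conv_integrable {v w : ℝ} (hv : 0 < v) (hw : 0 < w) (x y : ℝ) :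
    Integrable (fun η => gd v (x - η) * gd w (η - y)) := by
  have : ∀ η, gd v (x - η) * gd w (η - y) =
      gd (v + w) (x - y) * (η ^ 0 * gd (v * w / (v + w)) (η - (y + (x - y) * w / (v + w)))) := by
    intro η
    have := gd_mul hv hw (x - y) (η - y)
    rw [sub_sub_sub_cancel_right] at this
    rw [this, pow_zero, one_mul, sub_sub]
  simp_rw [this]
  exact (integrable_pow_gd (by positivity) _ 0).const_mul _

lemma heat_conv {v w : ℝ} (hv : 0 < v) (hw : 0 < w) (x y : ℝ) :
    ∫ η, gd v (x - η) * gd w (η - y) = gd (v + w) (x - y) := by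
  have : ∀ η, gd v (x - η) * gd w (η - y) =
      gd (v + w) (x - y) * (gd (v * w / (v + w)) (η - (y + (x - y) * w / (v + w)))) := by
    intro η
    have := gd_mul hv hw (x - y) (η - y)
    rw [sub_sub_sub_cancel_right] at this
    rw [this, sub_sub]
  simp_rw [this, MeasureTheory.integral_const_mul]
  rw [integral_gd (by positivity), mul_one]

lemma Gk_mul {c u r : ℝ} (hc : 0 < c) (hu : 0 < u) (hr : 0 < r) (ζ η : ℝ) :
    Gk c u (ζ - η) * Gk c r η = Gk c (u + r) ζ *
      gd (c * u * r / (u + r)) (η - ζ * r / (u + r)) := by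
  unfold Gk
  have h := gd_mul (mul_pos hc hu) (mul_pos hc hr) ζ η
  have e1 : c * u + c * r = c * (u + r) := by ring
  have e2 : c * u * (c * r) / (c * (u + r)) = c * u * r / (u + r) := by field_simp
  have e3 : ζ * (c * r) / (c * (u + r)) = ζ * r / (u + r) := by field_simp
  rw [e1, e2, e3] at h
  have e : Real.exp ((ζ - η) / 2 - c * u / 8) * Real.exp (η / 2 - c * r / 8)
      = Real.exp (ζ / 2 - c * (u + r) / 8) := by
    rw [← Real.exp_add]; congr 1; ring
  calc _ = (Real.exp ((ζ - η) / 2 - c * u / 8) * Real.exp (η / 2 - c * r / 8)) *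
      (gd (c * u) (ζ - η) * gd (c * r) η) := by ring
    _ = _ := by rw [e, h]; ring

lemma conv_integrable {c u r : ℝ} (hc : 0 < c) (hu : 0 < u) (hr : 0 < r) (x y : ℝ) (k : ℝ) (q : ℕ) :
    Integrable (fun η => Gk c u (x - η) * (Gk c r (η - y) * (k * (η - y)^q))) := by
  have h := ((integrable_pow_gd (v := c * u * r / (u + r)) (by positivity)
    ((x - y) * r / (u + r)) q).const_mul (Gk c (u + r) (x - y) * k)).comp_sub_right y
  refine h.congr (ae_of_all _ fun η => ?_)
  have := Gk_mul hc hu hr (x - y) (η - y)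
  rw [sub_sub_sub_cancel_right] at this
  simp only
  linear_combination -(k * (η - y)^q) * this

lemma conv_eq {c u r : ℝ} (hc : 0 < c) (hu : 0 < u) (hr : 0 < r) (x y : ℝ) (k : ℝ) (q : ℕ) :
    ∫ η, (Gk c u (x - η) * (Gk c r (η - y) * (k * (η - y)^q))) =
      Gk c (u + r) (x - y) * (k * He ((x - y) * r / (u + r)) (c * u * r / (u + r)) q) := by
  rw [← moment (v := c * u * r / (u + r)) (by positivity), ← mul_assoc, ← MeasureTheory.integral_const_mul,
    ← integral_sub_right_eq_self (fun z => Gk c (u + r) (x - y) * k *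
      (z ^ q * gd (c * u * r / (u + r)) (z - (x - y) * r / (u + r)))) y]
  congr 1
  funext η
  have := Gk_mul hc hu hr (x - y) (η - y)
  rw [sub_sub_sub_cancel_right] at this
  linear_combination (k * (η - y)^q) * this

lemma hasDerivAt_Gk_z {c τ : ℝ} (hc : 0 < c) (hτ : 0 < τ) (ζ : ℝ) :
    HasDerivAt (fun z => Gk c τ z) (Gk c τ ζ * (1 / 2 - ζ / (c * τ))) ζ := by
  unfold Gk
  have h1 : HasDerivAt (fun z : ℝ => z / 2 - c * τ / 8) (1 / 2) ζ :=
    ((hasDerivAt_id ζ).div_const 2).sub_const _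
  refine (h1.exp.mul (hasDerivAt_gd_z (mul_pos hc hτ) ζ)).congr_deriv ?_
  ring

lemma hasDerivAt_Gk_t {c τ : ℝ} (hc : 0 < c) (hτ : 0 < τ) (ζ : ℝ) :
    HasDerivAt (fun s => Gk c s ζ) (Gk c τ ζ * (-c / 8 - 1 / (2 * τ) + ζ^2 / (2 * c * τ^2))) τ := by
  unfold Gk gd
  have h1 : HasDerivAt (fun s : ℝ => ζ / 2 - c * s / 8) (-(c * 1 / 8)) τ :=
    (((hasDerivAt_id τ).const_mul c).div_const 8).const_sub _
  have h2 : HasDerivAt (fun s : ℝ => 2 * (c * s)) (2 * (c * 1)) τ :=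
    ((hasDerivAt_id τ).const_mul c).const_mul 2
  have h3 : HasDerivAt (fun s : ℝ => 2 * Real.pi * (c * s)) (2 * Real.pi * (c * 1)) τ :=
    ((hasDerivAt_id τ).const_mul c).const_mul _
  have h4 := (hasDerivAt_const τ (-ζ^2)).div h2 (by positivity)
  have h5 := (h3.sqrt (by positivity)).inv (by positivity)
  refine (h1.exp.mul (h5.mul h4.exp)).congr_deriv ?_
  have hp := Real.pi_pos
  have hs : Real.sqrt (2 * Real.pi * (c * τ)) ^ 2 = 2 * Real.pi * (c * τ) :=
    Real.sq_sqrt (by positivity)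
  have hs0 : 0 < Real.sqrt (2 * Real.pi * (c * τ)) := by positivity
  simp only [Pi.inv_apply, Pi.div_apply, Pi.mul_apply]
  rw [hs]
  field_simp
  ring

lemma contDiff_Gk (c τ : ℝ) : ContDiff ℝ 2 (fun z => Gk c τ z) := by
  unfold Gk gd
  fun_prop

lemma He_zero_var (μ : ℝ) : ∀ q : ℕ, He μ 0 q = μ^q
  | 0 => by simp [He]
  | 1 => by simp [He]
  | (q+2) => by simp [He, He_zero_var μ (q+1)]; ring

/-- The bridge moment polynomial. -/
def Aq (c τ ζ : ℝ) (q : ℕ) (r : ℝ) : ℝ := He (ζ * r / τ) (c * (τ - r) * r / τ) q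

lemma Aq_rec (c τ ζ : ℝ) (q : ℕ) (r : ℝ) : Aq c τ ζ (q+2) r =
    (ζ * r / τ) * Aq c τ ζ (q+1) r + (q+1) * (c * (τ - r) * r / τ) * Aq c τ ζ q r := by
  simp [Aq, He]

lemma Aq_deriv {c τ : ℝ} (hτ : 0 < τ) (ζ : ℝ) (r : ℝ) (hr : 0 < r) : ∀ q : ℕ,
    HasDerivAt (Aq c τ ζ q)
      (q * Aq c τ ζ q r / r - c / 2 * q * ((q:ℝ)-1) * Aq c τ ζ (q-2) r) r ∧
    HasDerivAt (Aq c τ ζ (q+1))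
      (((q+1:ℕ):ℝ) * Aq c τ ζ (q+1) r / r - c / 2 * ((q+1:ℕ):ℝ) * (((q+1:ℕ):ℝ)-1)
        * Aq c τ ζ (q+1-2) r) r := by
  have hμ : HasDerivAt (fun r : ℝ => ζ * r / τ) (ζ * 1 / τ) r :=
    ((hasDerivAt_id r).const_mul ζ).div_const τ
  have hv : HasDerivAt (fun r : ℝ => c * (τ - r) * r / τ) ((c * (-1) * r + c * (τ - r) * 1) / τ) r :=
    ((((hasDerivAt_id r).const_sub τ).const_mul c).mul (hasDerivAt_id r)).div_const τ
  intro q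
  induction q with
  | zero =>
    constructor
    · have : Aq c τ ζ 0 = fun _ => 1 := by funext r; simp [Aq, He]
      rw [this]; simpa using hasDerivAt_const r (1:ℝ)
    · have : Aq c τ ζ (0+1) = fun r => ζ * r / τ := by funext r; simp [Aq, He]
      rw [this]; refine hμ.congr_deriv ?_
      simp; field_simp
  | succ q ih =>
    refine ⟨ih.2, ?_⟩
    have : Aq c τ ζ (q+1+1) = fun r => (ζ * r / τ) * Aq c τ ζ (q+1) r
        + (q+1) * (c * (τ - r) * r / τ) * Aq c τ ζ q r := by
      funext r; exact Aq_rec c τ ζ q r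
    rw [this]
    refine ((hμ.mul ih.2).add ((hv.const_mul ((q:ℝ)+1)).mul ih.1)).congr_deriv ?_
    have e3 : q + 1 + 1 - 2 = q := by omega
    rw [e3]
    rcases q with _ | _ | q
    · simp [Aq, He]; field_simp; ring
    · simp [Aq, He]; field_simp; ring
    · have e1 : q + 1 + 1 + 1 - 2 = q + 1 := by omega
      have e2 : q + 1 + 1 - 2 = q := by omega
      rw [e1, e2]
      have r1 := Aq_rec c τ ζ q r
      have r2 := Aq_rec c τ ζ (q+1) r
      simp only [add_assoc, Nat.reduceAdd] at r1 r2 ⊢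
      rw [r2, r1]
      push_cast
      field_simp
      ring

lemma Aq_factor (c τ ζ : ℝ) : ∀ q : ℕ, 
    ∃ g : ℝ → ℝ, Continuous g ∧ ∀ r, Aq c τ ζ q r = r^((q+1)/2) * g r := by
  have key : ∀ q : ℕ, (∃ g : ℝ → ℝ, Continuous g ∧ ∀ r, Aq c τ ζ q r = r^((q+1)/2) * g r) ∧
    (∃ g : ℝ → ℝ, Continuous g ∧ ∀ r, Aq c τ ζ (q+1) r = r^((q+1+1)/2) * g r) := by
    intro q
    induction q with
    | zero =>
      refine ⟨⟨fun _ => 1, by fun_prop, fun r => by simp [Aq, He]⟩,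
        ⟨fun _ => ζ / τ, by fun_prop, fun r => by simp [Aq, He]; ring⟩⟩
    | succ q ih =>
      refine ⟨ih.2, ?_⟩
      obtain ⟨⟨g, hg, eg⟩, ⟨g', hg', eg'⟩⟩ := ih
      refine ⟨fun r => ζ / τ * r^((q+1+1)/2 - (q+1)/2) * g' r + (q+1) * (c * (τ - r) / τ) * g r,
        by fun_prop, fun r => ?_⟩
      have e1 : (q+1+1+1)/2 = (q+1)/2 + 1 := by omega
      have e2 : r^((q+1+1)/2) = r^((q+1)/2) * r^((q+1+1)/2 - (q+1)/2) := by
        rw [← pow_add]; congr 1; omega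
      rw [Aq_rec, eg, eg', e1, pow_succ, e2]
      ring
  exact fun q => (key q).1

lemma zpow_nat_split {p : ℤ} {k : ℕ} (h : 0 ≤ p + k) {r : ℝ} (hr : r ≠ 0) :
    r^p * r^k = r^(p + k).toNat := by
  rw [← zpow_natCast r k, ← zpow_add₀ hr, ← zpow_natCast r (p+k).toNat, Int.toNat_of_nonneg h]

lemma Aq_intervalIntegrable {c τ : ℝ} (hτ : 0 < τ) (ζ : ℝ) (p : ℤ) (q : ℕ)
    (h : -1 ≤ 2 * p + q) :
    IntervalIntegrable (fun r => r^p * Aq c τ ζ q r) volume 0 τ := by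
  obtain ⟨g, hg, e⟩ := Aq_factor c τ ζ q
  have hc : Continuous (fun r : ℝ => r^(p + ((q+1)/2 : ℕ)).toNat * g r) := by fun_prop
  refine (hc.intervalIntegrable 0 τ).congr_uIoo fun r hr => ?_
  rw [uIoo_of_le hτ.le] at hr
  simp only
  rw [e, ← mul_assoc, zpow_nat_split (by omega) hr.1.ne']

lemma Aq_ftc {c τ : ℝ} (hτ : 0 < τ) (ζ : ℝ) (p : ℤ) (q : ℕ)
    (h : -1 ≤ 2 * p + q) :
    ∫ r in (0:ℝ)..τ, (((p:ℝ) + q + 1) * (r^p * Aq c τ ζ q r)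
      - c / 2 * q * ((q:ℝ) - 1) * (r^(p+1) * Aq c τ ζ (q-2) r)) = τ^(p+1) * ζ^q := by
  obtain ⟨g, hg, e⟩ := Aq_factor c τ ζ q
  set k := (p + ((q+1)/2 : ℕ)).toNat with hk
  have hc : Continuous (fun r : ℝ => r^(k+1) * g r) := by fun_prop
  have heq : ∀ r : ℝ, 0 < r → r^(k+1) * g r = r^(p+1) * Aq c τ ζ q r := by
    intro r hr
    rw [e, zpow_add_one₀ hr.ne', pow_succ, hk, ← zpow_nat_split (by omega) hr.ne']
    ring
  have i1 := (Aq_intervalIntegrable (c := c) hτ ζ p q h).const_mul ((p:ℝ) + q + 1)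
  have i2 := (Aq_intervalIntegrable (c := c) hτ ζ (p+1) (q-2) (by omega)).const_mul
    (c / 2 * q * ((q:ℝ) - 1))
  have key := integral_eq_sub_of_hasDerivAt_of_le (f := fun r : ℝ => r^(k+1) * g r)
    (f' := fun r => ((p:ℝ) + q + 1) * (r^p * Aq c τ ζ q r)
      - c / 2 * q * ((q:ℝ) - 1) * (r^(p+1) * Aq c τ ζ (q-2) r)) hτ.le hc.continuousOn
    (fun r hr => by
      have hd : HasDerivAt (fun r : ℝ => r^(p+1) * Aq c τ ζ q r) _ r :=
        (hasDerivAt_zpow (p+1) r (Or.inl hr.1.ne')).mul (Aq_deriv hτ ζ r hr.1 q).1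
      have hd' := hd.congr_of_eventuallyEq (f₁ := fun r : ℝ => r^(k+1) * g r) (by
        filter_upwards [lt_mem_nhds hr.1] with z hz using heq z hz)
      refine hd'.congr_deriv ?_
      have := hr.1.ne'
      rw [add_sub_cancel_right, zpow_add_one₀ this]
      push_cast
      field_simp
      ring) (i1.sub i2)
  rw [key, heq τ hτ]
  have : Aq c τ ζ q τ = ζ^q := by
    simp only [Aq, sub_self, mul_zero, zero_mul, zero_div]
    rw [He_zero_var, mul_div_cancel_right₀ _ hτ.ne']
  rw [this]; simp

/-- The operator `∂_{zz} - ∂_z`. -/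
def Aop (F : ℝ → ℝ) (z : ℝ) : ℝ := iteratedDeriv 2 F z - deriv F z

lemma Aop_add {F H : ℝ → ℝ} (hF : ContDiff ℝ 2 F) (hH : ContDiff ℝ 2 H) (z : ℝ) :
    Aop (fun z => F z + H z) z = Aop F z + Aop H z := by
  unfold Aop
  have h1 := iteratedDeriv_add (n := 2) (x := z) hF.contDiffAt hH.contDiffAt
  have h2 := deriv_add (x := z) (hF.differentiable (by norm_num)).differentiableAt
    (hH.differentiable (by norm_num)).differentiableAt
  change iteratedDeriv 2 (F + H) z - deriv (F + H) z = _
  rw [h1, h2]; ring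

lemma Aop_const_mul (k : ℝ) (F : ℝ → ℝ) (z : ℝ) :
    Aop (fun z => k * F z) z = k * Aop F z := by
  unfold Aop
  rw [iteratedDeriv_const_mul_field, deriv_const_mul_field]; ring

lemma Aop_sum {ι : Type*} (s : Finset ι) (F : ι → ℝ → ℝ) (hF : ∀ i ∈ s, ContDiff ℝ 2 (F i)) (z : ℝ) :
    Aop (fun z => ∑ i ∈ s, F i z) z = ∑ i ∈ s, Aop (F i) z := by
  classical
  induction s using Finset.induction_on with
  | empty => simp [Aop, iteratedDeriv_succ]
  | insert i s hi ih =>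
    simp only [Finset.sum_insert hi]
    rw [Aop_add (hF i (by simp)) (ContDiff.sum fun j hj => hF j (by simp [hj])),
      ih fun j hj => hF j (by simp [hj])]

lemma Aop_shift (F : ℝ → ℝ) (y z : ℝ) : Aop (fun z => F (z - y)) z = Aop F (z - y) := by
  unfold Aop
  rw [iteratedDeriv_comp_sub_const, deriv_comp_sub_const]

lemma Aop_of_hasDerivAt {F F1 : ℝ → ℝ} {F2 z : ℝ} (h1 : ∀ z, HasDerivAt F (F1 z) z)
    (h2 : HasDerivAt F1 F2 z) : Aop F z = F2 - F1 z := by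
  unfold Aop
  have : deriv F = F1 := funext fun z => (h1 z).deriv
  rw [iteratedDeriv_succ, iteratedDeriv_one, this, h2.deriv]

lemma hasDerivAt_mono {c τ : ℝ} (hc : 0 < c) (hτ : 0 < τ) (k : ℝ) (q : ℕ) (z : ℝ) :
    HasDerivAt (fun z => Gk c τ z * (k * z^q))
      (Gk c τ z * (k / 2 * z^q) - Gk c τ z * (k / (c * τ) * z^(q+1)) + Gk c τ z * (k * q * z^(q-1)))
      z := by
  refine ((hasDerivAt_Gk_z hc hτ z).mul ((hasDerivAt_pow q z).const_mul k)).congr_deriv ?_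
  field_simp
  ring

lemma Aop_mono {c τ : ℝ} (hc : 0 < c) (hτ : 0 < τ) (k : ℝ) (q : ℕ) (z : ℝ) :
    Aop (fun z => Gk c τ z * (k * z^q)) z = Gk c τ z * (k *
      (z^q * (-1/4 - 1 / (c*τ) + z^2/(c*τ)^2) - 2 * q * z^q / (c*τ) 
        + q * ((q:ℝ)-1) * z^(q-2))) := by
  have h2 := ((hasDerivAt_mono hc hτ (k/2) q z).sub (hasDerivAt_mono hc hτ (k/(c*τ)) (q+1) z)).add
    (hasDerivAt_mono hc hτ (k*q) (q-1) z)
  rw [Aop_of_hasDerivAt (hasDerivAt_mono hc hτ k q) h2]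
  rcases q with _ | _ | q
  · simp; field_simp; ring
  · simp; field_simp; ring
  · simp only [Nat.add_sub_cancel, Nat.reduceSubDiff]
    push_cast
    have : q + 1 + 1 - 1 = q + 1 := by omega
    field_simp
    ring

/-- `S` is the explicit Duhamel integral of `f` (both multiplied by the Gaussian kernel). -/
structure Ev (c : ℝ) (f S : ℝ → ℝ → ℝ) : Prop where
  smooth : ∀ τ, ContDiff ℝ 2 (S τ)
  pde : ∀ τ ζ, 0 < τ → HasDerivAt (fun s => Gk c s ζ * S s ζ)
    (Gk c τ ζ * f τ ζ + c / 2 * Aop (fun z => Gk c τ z * S τ z) ζ) τ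
  inner : ∀ t T x y : ℝ, ∀ s ∈ Ioo t T, Integrable
    (fun η => Gk c (s - t) (x - η) * (Gk c (T - s) (η - y) * f (T - s) (η - y)))
  outer : ∀ t T x y : ℝ, t < T → IntervalIntegrable
    (fun s => ∫ η, Gk c (s - t) (x - η) * (Gk c (T - s) (η - y) * f (T - s) (η - y))) volume t T
  duh : ∀ t T x y : ℝ, t < T →
    ∫ s in t..T, ∫ η, Gk c (s - t) (x - η) * (Gk c (T - s) (η - y) * f (T - s) (η - y))
     = Gk c (T - t) (x - y) * S (T - t) (x - y)

lemma Ev.zero (c : ℝ) : Ev c (fun _ _ => 0) (fun _ _ => 0) where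
  smooth τ := contDiff_const
  pde τ ζ _ := by simpa [Aop, iteratedDeriv_succ] using hasDerivAt_const τ (0:ℝ)
  inner t T x y s hs := by simp
  outer t T x y h := by simp
  duh t T x y h := by simp

lemma Ev.smul {c : ℝ} {f S : ℝ → ℝ → ℝ} (h : Ev c f S) (k : ℝ) :
    Ev c (fun τ ζ => k * f τ ζ) (fun τ ζ => k * S τ ζ) where
  smooth τ := contDiff_const.mul (h.smooth τ)
  pde τ ζ hτ := by
    have e : ∀ s z, Gk c s z * (k * S s z) = k * (Gk c s z * S s z) := fun s z => by ring
    simp only [e, Aop_const_mul]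
    refine ((h.pde τ ζ hτ).const_mul k).congr_deriv (by ring)
  inner t T x y s hs := by
    refine ((h.inner t T x y s hs).const_mul k).congr (ae_of_all _ fun η => ?_)
    simp only; ring
  outer t T x y ht := by
    refine ((h.outer t T x y ht).const_mul k).congr fun s hs => ?_
    rw [← MeasureTheory.integral_const_mul]
    congr 1; funext η; ring
  duh t T x y ht := by
    have := h.duh t T x y ht
    have e : ∀ s η, Gk c (s - t) (x - η) * (Gk c (T - s) (η - y) * (k * f (T - s) (η - y))) =
      k * (Gk c (s - t) (x - η) * (Gk c (T - s) (η - y) * f (T - s) (η - y))) := fun s η => by ring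
    simp only [e, MeasureTheory.integral_const_mul, intervalIntegral.integral_const_mul]
    rw [this]; ring

lemma Ev.add {c : ℝ} {f S f' S' : ℝ → ℝ → ℝ} (h : Ev c f S) (h' : Ev c f' S') :
    Ev c (fun τ ζ => f τ ζ + f' τ ζ) (fun τ ζ => S τ ζ + S' τ ζ) := by
  have e : ∀ t T x y : ℝ, ∀ s ∈ Ioo t T,
      ∫ η, Gk c (s - t) (x - η) * (Gk c (T - s) (η - y) * (f (T - s) (η - y) + f' (T - s) (η - y)))
      = (∫ η, Gk c (s - t) (x - η) * (Gk c (T - s) (η - y) * f (T - s) (η - y)))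
       + ∫ η, Gk c (s - t) (x - η) * (Gk c (T - s) (η - y) * f' (T - s) (η - y)) := by
    intro t T x y s hs
    rw [← MeasureTheory.integral_add (h.inner t T x y s hs) (h'.inner t T x y s hs)]
    congr 1; funext η; ring
  refine ⟨fun τ => (h.smooth τ).add (h'.smooth τ), ?_, ?_, ?_, ?_⟩
  · intro τ ζ hτ
    have e : ∀ s z, Gk c s z * (S s z + S' s z) = Gk c s z * S s z + Gk c s z * S' s z :=
      fun s z => by ring
    simp only [e]
    rw [Aop_add ((contDiff_Gk c τ).mul (h.smooth τ)) ((contDiff_Gk c τ).mul (h'.smooth τ))]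
    refine ((h.pde τ ζ hτ).add (h'.pde τ ζ hτ)).congr_deriv (by ring)
  · intro t T x y s hs
    refine ((h.inner t T x y s hs).add (h'.inner t T x y s hs)).congr (ae_of_all _ fun η => ?_)
    simp only [Pi.add_apply]; ring
  · intro t T x y ht
    refine ((h.outer t T x y ht).add (h'.outer t T x y ht)).congr_uIoo fun s hs => ?_
    rw [uIoo_of_le ht.le] at hs
    exact (e t T x y s hs).symm
  · intro t T x y ht
    rw [integral_congr_Ioo_of_le ht.le (fun s hs => e t T x y s hs),
      intervalIntegral.integral_add (h.outer t T x y ht) (h'.outer t T x y ht),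
      h.duh t T x y ht, h'.duh t T x y ht]
    ring

lemma Ev.base {c : ℝ} (hc : 0 < c) (p : ℤ) (q : ℕ) (hpq : -1 ≤ 2 * p + q) :
    Ev c (fun τ ζ => ((p:ℝ) + q + 1) * τ^p * ζ^q - c / 2 * q * ((q:ℝ) - 1) * τ^(p+1) * ζ^(q-2))
      (fun τ ζ => τ^(p+1) * ζ^q) := by
  have split : ∀ t T x y s η : ℝ, Gk c (s - t) (x - η) * (Gk c (T - s) (η - y) *
      (((p:ℝ) + q + 1) * (T-s)^p * (η-y)^q - c / 2 * q * ((q:ℝ) - 1) * (T-s)^(p+1) * (η-y)^(q-2)))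
      = Gk c (s - t) (x - η) * (Gk c (T - s) (η - y) * ((((p:ℝ) + q + 1) * (T-s)^p) * (η-y)^q))
      - Gk c (s - t) (x - η) * (Gk c (T - s) (η - y) * ((c / 2 * q * ((q:ℝ) - 1) * (T-s)^(p+1))
         * (η-y)^(q-2))) := fun t T x y s η => by ring
  have i1 : ∀ t T x y : ℝ, ∀ s ∈ Ioo t T, Integrable (fun η =>
      Gk c (s - t) (x - η) * (Gk c (T - s) (η - y) * ((((p:ℝ) + q + 1) * (T-s)^p) * (η-y)^q))) :=
    fun t T x y s hs => conv_integrable hc (by linarith [hs.1]) (by linarith [hs.2]) _ _ _ _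
  have i2 : ∀ t T x y : ℝ, ∀ s ∈ Ioo t T, Integrable (fun η =>
      Gk c (s - t) (x - η) * (Gk c (T - s) (η - y) * ((c / 2 * q * ((q:ℝ) - 1) * (T-s)^(p+1))
         * (η-y)^(q-2)))) :=
    fun t T x y s hs => conv_integrable hc (by linarith [hs.1]) (by linarith [hs.2]) _ _ _ _
  have e : ∀ t T x y : ℝ, ∀ s ∈ Ioo t T, ∫ η, Gk c (s - t) (x - η) * (Gk c (T - s) (η - y) *
      (((p:ℝ) + q + 1) * (T-s)^p * (η-y)^q - c / 2 * q * ((q:ℝ) - 1) * (T-s)^(p+1) * (η-y)^(q-2)))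
      = Gk c (T - t) (x - y) * (((p:ℝ) + q + 1) * ((T-s)^p * Aq c (T-t) (x-y) q (T-s))
      - c / 2 * q * ((q:ℝ) - 1) * ((T-s)^(p+1) * Aq c (T-t) (x-y) (q-2) (T-s))) := by
    intro t T x y s hs
    simp only [split]
    rw [MeasureTheory.integral_sub (i1 t T x y s hs) (i2 t T x y s hs),
      conv_eq hc (by linarith [hs.1]) (by linarith [hs.2]),
      conv_eq hc (by linarith [hs.1]) (by linarith [hs.2])]
    have e1 : s - t + (T - s) = T - t := by ring
    have e2 : T - t - (T - s) = s - t := by ring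
    simp only [e1, Aq, e2]
    ring
  refine ⟨fun τ => by fun_prop, ?_, ?_, ?_, ?_⟩
  · intro τ ζ hτ
    rw [Aop_mono hc hτ]
    refine ((hasDerivAt_Gk_t hc hτ ζ).mul ((hasDerivAt_zpow (p+1) τ (Or.inl hτ.ne')).mul_const
      (ζ^q))).congr_deriv ?_
    rw [add_sub_cancel_right, zpow_add_one₀ hτ.ne']
    push_cast
    field_simp
    ring
  · intro t T x y s hs
    simp only [split]
    exact (i1 t T x y s hs).sub (i2 t T x y s hs)
  · intro t T x y ht
    have i1 := (Aq_intervalIntegrable (c := c) (sub_pos.2 ht) (x-y) p q hpq).const_mul ((p:ℝ) + q + 1)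
    have i2 := (Aq_intervalIntegrable (c := c) (sub_pos.2 ht) (x-y) (p+1) (q-2) (by omega)).const_mul
      (c / 2 * q * ((q:ℝ) - 1))
    have i3 := (((i1.sub i2).const_mul (Gk c (T - t) (x - y))).comp_sub_left T).symm
    simp only [sub_zero, sub_sub_cancel] at i3
    refine i3.congr_uIoo fun s hs => ?_
    rw [uIoo_of_le ht.le] at hs
    exact (e t T x y s hs).symm
  · intro t T x y ht
    rw [integral_congr_Ioo_of_le ht.le (fun s hs => e t T x y s hs),
      intervalIntegral.integral_const_mul]
    congr 1
    have := intervalIntegral.integral_comp_sub_left (a := t) (b := T) (fun r =>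
      (((p:ℝ) + q + 1) * (r^p * Aq c (T-t) (x-y) q r)
      - c / 2 * q * ((q:ℝ) - 1) * (r^(p+1) * Aq c (T-t) (x-y) (q-2) r))) T
    rw [this, sub_self, Aq_ftc (sub_pos.2 ht) _ _ _ hpq]

section

/-- Families (indexed by parameters `θ`) of Laurent polynomials in `τ`, `ζ` with uniformly bounded
coefficients and parabolic weight at least `w`. -/
inductive InV {Θ : Type} (w : ℤ) : (Θ → ℝ → ℝ → ℝ) → Prop
  | zero : InV w (fun _ _ _ => 0)
  | mono (β : Θ → ℝ) (B : ℝ) (hB : ∀ θ, |β θ| ≤ B) (p : ℤ) (q : ℕ) (h : w ≤ 2 * p + q) :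
      InV w (fun θ τ ζ => β θ * τ^p * ζ^q)
  | add (u v : Θ → ℝ → ℝ → ℝ) (hu : InV w u) (hv : InV w v) :
      InV w (fun θ τ ζ => u θ τ ζ + v θ τ ζ)

variable {Θ : Type}

lemma InV.smul {w : ℤ} {u : Θ → ℝ → ℝ → ℝ} (hu : InV w u) (k : Θ → ℝ) (K : ℝ)
    (hk : ∀ θ, |k θ| ≤ K) : InV w (fun θ τ ζ => k θ * u θ τ ζ) := by
  induction hu with
  | zero => simpa using InV.zero
  | mono β B hB p q h =>
    have := InV.mono (w := w) (fun θ => k θ * β θ) (K * B) (fun θ => by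
      rw [abs_mul]
      exact mul_le_mul (hk θ) (hB θ) (abs_nonneg _) ((abs_nonneg _).trans (hk θ))) p q h
    simpa only [mul_assoc] using this
  | add u v _ _ h1 h2 =>
    have := InV.add _ _ h1 h2
    simpa only [mul_add] using this

lemma InV.mul_pow {w : ℤ} {u : Θ → ℝ → ℝ → ℝ} (hu : InV w u) (n : ℕ) :
    InV (w + n) (fun θ τ ζ => ζ^n * u θ τ ζ) := by
  induction hu with
  | zero => simpa using InV.zero
  | mono β B hB p q h =>
    have := InV.mono (w := w + n) β B hB p (q + n) (by push_cast; omega)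
    have e : (fun (θ : Θ) τ ζ => ζ^n * (β θ * τ^p * ζ^q)) = fun θ τ ζ => β θ * τ^p * ζ^(q+n) := by
      funext θ τ ζ; rw [pow_add]; ring
    rw [e]; exact this
  | add u v _ _ h1 h2 =>
    have := InV.add _ _ h1 h2
    simpa only [mul_add] using this

lemma InV.sum {ι : Type*} {w : ℤ} (s : Finset ι) (u : ι → Θ → ℝ → ℝ → ℝ) (hu : ∀ i ∈ s, InV w (u i)) :
    InV w (fun θ τ ζ => ∑ i ∈ s, u i θ τ ζ) := by
  classical
  induction s using Finset.induction_on with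
  | empty => simpa using InV.zero
  | insert i s hi ih =>
    simp only [Finset.sum_insert hi]
    exact InV.add _ _ (hu i (by simp)) (ih fun j hj => hu j (by simp [hj]))

lemma InV.smooth {w : ℤ} {u : Θ → ℝ → ℝ → ℝ} (hu : InV w u) (θ : Θ) (τ : ℝ) :
    ContDiff ℝ 2 (u θ τ) := by
  induction hu with
  | zero => exact contDiff_const
  | mono β B hB p q h => fun_prop
  | add u v _ _ h1 h2 => exact h1.add h2

lemma InV.aop {c : Θ → ℝ} {m : ℝ} (hm : 0 < m) (hc : ∀ θ, 2 * m ≤ c θ) {w : ℤ}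
    {u : Θ → ℝ → ℝ → ℝ} (hu : InV w u) :
    ∃ g, InV (w - 2) g ∧ ∀ θ τ ζ, 0 < τ →
      Aop (fun z => Gk (c θ) τ z * u θ τ z) ζ = Gk (c θ) τ ζ * g θ τ ζ := by
  have hc0 : ∀ θ, 0 < c θ := fun θ => by linarith [hc θ]
  induction hu with
  | zero => exact ⟨_, InV.zero, fun θ τ ζ _ => by simp [Aop]⟩
  | mono β B hB p q h =>
    have hinv : ∀ θ, |1 / c θ| ≤ 1 / (2 * m) := fun θ => by
      rw [abs_of_pos (by have := hc0 θ; positivity)]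
      exact one_div_le_one_div_of_le (by positivity) (hc θ)
    have m1 := (InV.mono (w := w - 2) β B hB p q (by omega)).smul (fun _ => -1/4) _ (fun _ => le_rfl)
    have m2 := ((InV.mono (w := w - 2) β B hB (p-1) q (by omega)).smul _ _ hinv).smul
      (fun _ => -1 - 2 * q) _ (fun _ => le_rfl)
    have m3 := ((InV.mono (w := w - 2) β B hB (p-2) (q+2) (by push_cast; omega)).smul _ _ hinv).smul
      _ _ hinv
    have m4 := (InV.mono (w := w - 2) β B hB p (q-2) (by omega)).smul (fun _ => q * ((q:ℝ)-1)) _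
      (fun _ => le_rfl)
    refine ⟨_, InV.add _ _ (InV.add _ _ m1 m2) (InV.add _ _ m3 m4), fun θ τ ζ hτ => ?_⟩
    rw [Aop_mono (hc0 θ) hτ]
    have := hc0 θ
    have e1 : τ^(p-1) = τ^p / τ := by rw [zpow_sub_one₀ hτ.ne']; rfl
    have e2 : τ^(p-2) = τ^p / τ^2 := by rw [zpow_sub₀ hτ.ne']; rfl
    rw [e1, e2]
    field_simp
    ring
  | add u v hu hv h1 h2 =>
    obtain ⟨g1, a1, b1⟩ := h1
    obtain ⟨g2, a2, b2⟩ := h2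
    refine ⟨_, InV.add _ _ a1 a2, fun θ τ ζ hτ => ?_⟩
    simp only [mul_add]
    rw [Aop_add ((contDiff_Gk _ _).mul (hu.smooth θ τ)) ((contDiff_Gk _ _).mul (hv.smooth θ τ)),
      b1 θ τ ζ hτ, b2 θ τ ζ hτ]

lemma InV.duh_mono {c : Θ → ℝ} {m M : ℝ} (hm : 0 < m) (hc : ∀ θ, 2 * m ≤ c θ ∧ c θ ≤ 2 * M) {w : ℤ}
    (hw : -1 ≤ w) (q : ℕ) : ∀ (p : ℤ) (β : Θ → ℝ) (B : ℝ) (_ : ∀ θ, |β θ| ≤ B) (_ : w ≤ 2 * p + q),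
    ∃ S, InV (w + 2) S ∧ ∀ θ, Ev (c θ) (fun τ ζ => β θ * τ^p * ζ^q) (S θ) := by
  have hc0 : ∀ θ, 0 < c θ := fun θ => by linarith [(hc θ).1]
  induction q using Nat.strong_induction_on with
  | _ q ih =>
    intro p β B hB h
    have hpos : (0:ℝ) < (p:ℝ) + q + 1 := by
      have : 0 < p + q + 1 := by omega
      exact_mod_cast this
    set k : ℝ := ((p:ℝ) + q + 1)⁻¹ with hk
    have hkk : k * ((p:ℝ) + q + 1) = 1 := inv_mul_cancel₀ hpos.ne'
    have s1 := InV.mono (w := w + 2) (fun θ => k * β θ) (|k| * B) (fun θ => by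
      rw [abs_mul]; exact mul_le_mul_of_nonneg_left (hB θ) (abs_nonneg _)) (p+1) q (by omega)
    have base : ∀ θ, Ev (c θ) _ _ := fun θ => (Ev.base (hc0 θ) p q (by omega)).smul (k * β θ)
    by_cases hq : q < 2
    · refine ⟨_, s1, fun θ => ?_⟩
      convert base θ using 3 with τ ζ τ ζ
      · have : (q:ℝ) * ((q:ℝ) - 1) = 0 := by
          interval_cases q <;> simp
        linear_combination (-β θ * τ^p * ζ^q) * hkk +
          k * β θ * (c θ / 2 * τ^(p+1) * ζ^(q-2)) * this
      · ring
    · obtain ⟨S, hS, hE⟩ := ih (q-2) (by omega) (p+1)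
        (fun θ => k * β θ * (c θ / 2 * q * ((q:ℝ) - 1))) (|k| * B * (M * |(q:ℝ) * ((q:ℝ) - 1)|))
        (fun θ => by
          rw [abs_mul, abs_mul]
          refine mul_le_mul (mul_le_mul_of_nonneg_left (hB θ) (abs_nonneg _)) ?_ (abs_nonneg _)
            (mul_nonneg (abs_nonneg _) ((abs_nonneg _).trans (hB θ)))
          rw [mul_assoc, abs_mul]
          refine mul_le_mul_of_nonneg_right ?_ (abs_nonneg _)
          rw [abs_of_pos (by linarith [hc0 θ])]
          linarith [(hc θ).2]) (by omega)
      refine ⟨_, InV.add _ _ s1 hS, fun θ => ?_⟩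
      convert (base θ).add (hE θ) using 3 with τ ζ τ ζ
      · linear_combination (-β θ * τ^p * ζ^q) * hkk
      · ring

lemma InV.duh {c : Θ → ℝ} {m M : ℝ} (hm : 0 < m) (hc : ∀ θ, 2 * m ≤ c θ ∧ c θ ≤ 2 * M) {w : ℤ}
    (hw : -1 ≤ w) {f : Θ → ℝ → ℝ → ℝ} (hf : InV w f) :
    ∃ S, InV (w + 2) S ∧ ∀ θ, Ev (c θ) (f θ) (S θ) := by
  induction hf with
  | zero => exact ⟨_, InV.zero, fun θ => Ev.zero _⟩
  | mono β B hB p q h => exact InV.duh_mono hm hc hw q p β B hB h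
  | add u v _ _ h1 h2 =>
    obtain ⟨S1, a1, b1⟩ := h1
    obtain ⟨S2, a2, b2⟩ := h2
    exact ⟨_, InV.add _ _ a1 a2, fun θ => (b1 θ).add (b2 θ)⟩

lemma Gk_bound {m M ε τ0 : ℝ} (hm : 0 < m) (hM : m ≤ M) (hε : 0 < ε) (hτ0 : 0 < τ0) (p : ℤ) (q : ℕ)
    (w : ℤ) (hw : w ≤ 2 * p + q) :
    ∃ C, 0 ≤ C ∧ ∀ c τ ζ, 2 * m ≤ c → c ≤ 2 * M → 0 < τ → τ ≤ τ0 →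
      |Gk c τ ζ * (τ^p * ζ^q)| ≤ C * τ^((w:ℝ)/2) * gd (2 * (M + ε) * τ) ζ := by
  have hM0 : 0 < M := by linarith
  set δ : ℝ := 1 / (4 * M) - 1 / (4 * (M + ε)) with hδ
  have hδ0 : 0 < δ := by
    rw [hδ, sub_pos]
    exact one_div_lt_one_div_of_lt (by positivity) (by linarith)
  set k : ℝ := 1 + Real.sqrt τ0 / 2 with hk
  refine ⟨Real.sqrt ((M + ε) / m) * q.factorial * Real.exp (k^2 / (4 * δ)) *
    τ0^((2 * (p:ℝ) + q - w) / 2), by positivity, ?_⟩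
  intro c τ ζ hc1 hc2 hτ hττ
  have hc0 : 0 < c := by linarith
  set σ := Real.sqrt τ with hσ
  have hσ0 : 0 < σ := Real.sqrt_pos.2 hτ
  have hσ2 : σ^2 = τ := Real.sq_sqrt hτ.le
  set X := |ζ| / σ with hX
  have hX0 : 0 ≤ X := by positivity
  have hζ : |ζ| = X * σ := by rw [hX]; field_simp
  have hζ2 : ζ^2 = X^2 * τ := by rw [← sq_abs, hζ, mul_pow, hσ2]
  -- exponential part
  have hexp : Real.exp (ζ / 2 - c * τ / 8) * Real.exp (-ζ^2 / (2 * (c * τ))) * X^q ≤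
      q.factorial * Real.exp (k^2 / (4 * δ)) * Real.exp (-ζ^2 / (2 * (2 * (M + ε) * τ))) := by
    have h1 : X^q ≤ q.factorial * Real.exp X := by
      have := Real.pow_div_factorial_le_exp X hX0 q
      rwa [div_le_iff₀' (by positivity)] at this
    have hs : σ ≤ Real.sqrt τ0 := Real.sqrt_le_sqrt hττ
    have h2 : (ζ / 2 - c * τ / 8) + -ζ^2 / (2 * (c * τ)) + X ≤
        k^2 / (4 * δ) + -ζ^2 / (2 * (2 * (M + ε) * τ)) := by
      have e1 : -ζ^2 / (2 * (c * τ)) ≤ - X^2 / (4 * M) := by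
        rw [hζ2, ← neg_mul, mul_comm c, ← mul_assoc, mul_comm 2 τ, mul_assoc, mul_comm, 
          mul_div_mul_left _ _ hτ.ne', neg_div, neg_div]
        apply neg_le_neg
        apply div_le_div_of_nonneg_left (by positivity) (by positivity) (by linarith)
      have e2 : -ζ^2 / (2 * (2 * (M + ε) * τ)) = - X^2 / (4 * (M + ε)) := by
        rw [hζ2]; field_simp; ring
      have e3 : ζ / 2 ≤ X * Real.sqrt τ0 / 2 := by
        have := le_abs_self ζ
        have := mul_le_mul_of_nonneg_left hs hX0
        linarith
      have e4 : k * X - δ * X^2 ≤ k^2 / (4 * δ) := by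
        rw [le_div_iff₀ (by positivity)]
        nlinarith [sq_nonneg (k - 2 * δ * X)]
      have e5 : δ * X^2 = X^2 / (4 * M) - X^2 / (4 * (M + ε)) := by rw [hδ]; ring
      have e6 : 0 < c * τ / 8 := by positivity
      have e7 : k * X = X + X * Real.sqrt τ0 / 2 := by rw [hk]; ring
      rw [e2]
      simp only [neg_div] at e1 ⊢
      linarith
    calc _ ≤ Real.exp (ζ / 2 - c * τ / 8) * Real.exp (-ζ^2 / (2 * (c * τ))) *
          (q.factorial * Real.exp X) := by gcongr
      _ = q.factorial * Real.exp ((ζ / 2 - c * τ / 8) + -ζ^2 / (2 * (c * τ)) + X) := by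
          rw [Real.exp_add, Real.exp_add]; ring
      _ ≤ q.factorial * Real.exp (k^2 / (4 * δ) + -ζ^2 / (2 * (2 * (M + ε) * τ))) := by gcongr
      _ = _ := by rw [Real.exp_add]; ring
  have hsq : (Real.sqrt (2 * Real.pi * (c * τ)))⁻¹ ≤ Real.sqrt ((M + ε) / m) *
      (Real.sqrt (2 * Real.pi * (2 * (M + ε) * τ)))⁻¹ := by
    have hp := Real.pi_pos
    rw [← Real.sqrt_inv, ← Real.sqrt_inv, ← Real.sqrt_mul (by positivity)]
    apply Real.sqrt_le_sqrt
    have : (M + ε) / m * (2 * Real.pi * (2 * (M + ε) * τ))⁻¹ = (2 * Real.pi * (2 * m * τ))⁻¹ := by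
      field_simp
    rw [this]
    gcongr
  have hpow : τ^p * σ^q ≤ τ^((w:ℝ)/2) * τ0^((2 * (p:ℝ) + q - w) / 2) := by
    have e1 : τ^p * σ^q = τ^((w:ℝ)/2) * τ^((2 * (p:ℝ) + q - w) / 2) := by
      rw [← Real.rpow_add hτ, hσ, Real.sqrt_eq_rpow, ← Real.rpow_natCast, ← Real.rpow_mul hτ.le,
        ← Real.rpow_intCast, ← Real.rpow_add hτ]
      congr 1; ring
    rw [e1]
    refine mul_le_mul_of_nonneg_left (Real.rpow_le_rpow hτ.le hττ ?_) (by positivity)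
    have : (w:ℝ) ≤ 2 * p + q := by exact_mod_cast hw
    linarith
  have hG : 0 ≤ Gk c τ ζ := mul_nonneg (Real.exp_nonneg _) (gd_nonneg _ _)
  rw [abs_mul, abs_of_nonneg hG, abs_mul, abs_pow, hζ, mul_pow, abs_of_pos (zpow_pos hτ p)]
  unfold Gk gd
  calc _ = (Real.sqrt (2 * Real.pi * (c * τ)))⁻¹ * (Real.exp (ζ / 2 - c * τ / 8) *
        Real.exp (-ζ^2 / (2 * (c * τ))) * X^q) * (τ^p * σ^q) := by ring
    _ ≤ (Real.sqrt ((M + ε) / m) * (Real.sqrt (2 * Real.pi * (2 * (M + ε) * τ)))⁻¹) *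
      (q.factorial * Real.exp (k^2 / (4 * δ)) * Real.exp (-ζ^2 / (2 * (2 * (M + ε) * τ)))) *
      (τ^((w:ℝ)/2) * τ0^((2 * (p:ℝ) + q - w) / 2)) := by
        refine mul_le_mul (mul_le_mul hsq hexp (by positivity) (by positivity)) hpow
          (by positivity) (by positivity)
    _ = _ := by ring

lemma InV.bound {c : Θ → ℝ} {m M ε τ0 : ℝ} (hm : 0 < m) (hM : m ≤ M) (hε : 0 < ε) (hτ0 : 0 < τ0)
    (hc : ∀ θ, 2 * m ≤ c θ ∧ c θ ≤ 2 * M) {w : ℤ} {u : Θ → ℝ → ℝ → ℝ} (hu : InV w u) :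
    ∃ C, 0 ≤ C ∧ ∀ θ τ ζ, 0 < τ → τ ≤ τ0 →
      |Gk (c θ) τ ζ * u θ τ ζ| ≤ C * τ^((w:ℝ)/2) * gd (2 * (M + ε) * τ) ζ := by
  induction hu with
  | zero => exact ⟨0, le_rfl, fun θ τ ζ _ _ => by simp⟩
  | mono β B hB p q h =>
    obtain ⟨C, hC, hb⟩ := Gk_bound hm hM hε hτ0 p q w h
    refine ⟨|B| * C, by positivity, fun θ τ ζ h1 h2 => ?_⟩
    have := hb (c θ) τ ζ (hc θ).1 (hc θ).2 h1 h2
    have e : Gk (c θ) τ ζ * (β θ * τ^p * ζ^q) = β θ * (Gk (c θ) τ ζ * (τ^p * ζ^q)) := by ring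
    rw [e, abs_mul, mul_assoc, mul_assoc, ← mul_assoc C]
    exact mul_le_mul ((hB θ).trans (le_abs_self B)) this (abs_nonneg _) (abs_nonneg _)
  | add u v _ _ h1 h2 =>
    obtain ⟨C1, a1, b1⟩ := h1
    obtain ⟨C2, a2, b2⟩ := h2
    refine ⟨C1 + C2, by positivity, fun θ τ ζ h1 h2 => ?_⟩
    rw [mul_add]
    refine (abs_add_le _ _).trans ?_
    have := b1 θ τ ζ h1 h2
    have := b2 θ τ ζ h1 h2
    linarith

end

lemma Ev.sum {ι : Type*} {c : ℝ} (s : Finset ι) (f S : ι → ℝ → ℝ → ℝ)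
    (h : ∀ i ∈ s, Ev c (f i) (S i)) :
    Ev c (fun τ ζ => ∑ i ∈ s, f i τ ζ) (fun τ ζ => ∑ i ∈ s, S i τ ζ) := by
  classical
  induction s using Finset.induction_on with
  | empty => simpa using Ev.zero c
  | insert i s hi ih =>
    simp only [Finset.sum_insert hi]
    exact Ev.add (h i (by simp)) (ih fun j hj => h j (by simp [hj]))

lemma G_rep {Θ : Type} {c : Θ → ℝ} {m M K T : ℝ} (hm : 0 < m)
    (hc : ∀ θ, 2 * m ≤ c θ ∧ c θ ≤ 2 * M) (N : ℕ) (α : ℕ → Θ → ℝ)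
    (hα : ∀ h ≤ N, ∀ θ, |α h θ| ≤ K) (y : Θ → ℝ) (G : Θ → ℕ → ℝ → ℝ → ℝ)
    (h0 : ∀ θ t x, t < T → G θ 0 t x = gaussK (c θ) t x T (y θ))
    (hG : ∀ θ n, 1 ≤ n → n ≤ N → ∀ t x, t < T → G θ n t x = ∑ h ∈ Finset.Icc 1 n,
      α h θ * ∫ s in t..T, ∫ η : ℝ, gaussK (c θ) t x s η * (η - y θ)^h *
        Aop (fun z => G θ (n - h) s z) η) (n : ℕ) : n ≤ N →
    ∃ g : Θ → ℝ → ℝ → ℝ, InV ((n:ℤ) - 2) g ∧ ∀ θ t x, t < T →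
      (ContDiff ℝ 2 (fun z => G θ n t z) ∧
      Aop (fun z => G θ n t z) x = Gk (c θ) (T - t) (x - y θ) * g θ (T - t) (x - y θ) ∧
      HasDerivAt (fun s => G θ n s x) (-(c θ / 2 * Aop (fun z => G θ n t z) x) -
        ∑ h ∈ Finset.Icc 1 n, α h θ * (x - y θ)^h * Aop (fun z => G θ (n - h) t z) x) t) := by
  have hc0 : ∀ θ, 0 < c θ := fun θ => by linarith [(hc θ).1]
  induction n using Nat.strong_induction_on with
  | _ n ih =>
    intro hnN
    rcases Nat.eq_zero_or_pos n with rfl | hn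
    · have hu : InV (Θ := Θ) (0:ℤ) (fun θ τ ζ => 1 * τ^(0:ℤ) * ζ^0) :=
        InV.mono (fun _ => 1) 1 (by simp) 0 0 (by simp)
      obtain ⟨g, hg, hgA⟩ := hu.aop hm (fun θ => (hc θ).1)
      refine ⟨g, by simpa using hg, fun θ t x ht => ?_⟩
      have e : ∀ s, s < T → ∀ z, G θ 0 s z = Gk (c θ) (T - s) (z - y θ) * 
          (1 * (T-s)^(0:ℤ) * (z - y θ)^0) := fun s hs z => by
        rw [h0 θ s z hs, gaussK_eq (hc0 θ) hs]; simp
      have e1 : (fun z => G θ 0 t z) = fun z => Gk (c θ) (T - t) (z - y θ) * 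
          (1 * (T-t)^(0:ℤ) * (z - y θ)^0) := funext (e t ht)
      have hA : Aop (fun z => G θ 0 t z) x =
          Aop (fun z => Gk (c θ) (T - t) z * (1 * (T-t)^(0:ℤ) * z^0)) (x - y θ) := by
        rw [e1]
        exact Aop_shift (fun z => Gk (c θ) (T - t) z * (1 * (T-t)^(0:ℤ) * z^0)) (y θ) x
      refine ⟨?_, ?_, ?_⟩
      · rw [e1]
        have := (contDiff_Gk (c θ) (T - t)).comp (contDiff_id.sub (contDiff_const (c := y θ)))
        simpa [Function.comp_def] using this
      · rw [hA, hgA θ (T-t) _ (by linarith)]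
      · have hd := (hasDerivAt_Gk_t (hc0 θ) (sub_pos.2 ht) (x - y θ)).comp_const_sub T t
        have hd' := hd.congr_of_eventuallyEq (f₁ := fun s => G θ 0 s x) (by
          filter_upwards [gt_mem_nhds ht] with s hs
          rw [e s hs]; simp)
        refine hd'.congr_deriv ?_
        rw [hA, Aop_mono (hc0 θ) (sub_pos.2 ht)]
        have := hc0 θ
        have := sub_pos.2 ht
        simp
        field_simp
        ring
    · have ih' : ∀ h ∈ Finset.Icc 1 n, ∃ g : Θ → ℝ → ℝ → ℝ, ∃ S : Θ → ℝ → ℝ → ℝ, 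
          InV (n:ℤ) S ∧ (∀ θ, Ev (c θ) (fun τ ζ => ζ^h * g θ τ ζ) (S θ)) ∧
          ∀ θ t x, t < T → Aop (fun z => G θ (n-h) t z) x =
            Gk (c θ) (T - t) (x - y θ) * g θ (T - t) (x - y θ) := by
        intro h hh
        rw [Finset.mem_Icc] at hh
        obtain ⟨g, hg, hgA⟩ := ih (n - h) (by omega) (by omega)
        have hf := hg.mul_pow h
        have hw : ((n - h : ℕ) : ℤ) - 2 + h = (n:ℤ) - 2 := by omega
        rw [hw] at hf
        obtain ⟨S, hS, hE⟩ := hf.duh hm hc (by omega)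
        rw [sub_add_cancel] at hS
        exact ⟨g, S, hS, hE, fun θ t x ht => (hgA θ t x ht).2.1⟩
      choose! g S hS hE hA using ih'
      have hu : InV (n:ℤ) (fun θ τ ζ => ∑ h ∈ Finset.Icc 1 n, α h θ * S h θ τ ζ) :=
        InV.sum _ _ fun h hh => (hS h hh).smul (α h) K
          (hα h (by rw [Finset.mem_Icc] at hh; omega))
      have hEu : ∀ θ, Ev (c θ) 
          (fun τ ζ => ∑ h ∈ Finset.Icc 1 n, α h θ * (ζ^h * g h θ τ ζ))
          (fun τ ζ => ∑ h ∈ Finset.Icc 1 n, α h θ * S h θ τ ζ) := fun θ =>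
        Ev.sum _ _ _ fun h hh => (hE h hh θ).smul (α h θ)
      have e : ∀ θ s, s < T → ∀ z, G θ n s z = Gk (c θ) (T - s) (z - y θ) * 
          ∑ h ∈ Finset.Icc 1 n, α h θ * S h θ (T - s) (z - y θ) := by
        intro θ t ht x
        rw [hG θ n hn hnN t x ht, Finset.mul_sum]
        refine Finset.sum_congr rfl fun h hh => ?_
        have hd := (hE h hh θ).duh t T x (y θ) ht
        have : ∫ s in t..T, ∫ η : ℝ, gaussK (c θ) t x s η * (η - y θ)^h *
            Aop (fun z => G θ (n - h) s z) η =
            Gk (c θ) (T - t) (x - y θ) * S h θ (T - t) (x - y θ) := by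
          rw [← hd]
          refine integral_congr_Ioo_of_le ht.le fun s hs => ?_
          refine MeasureTheory.integral_congr_ae (ae_of_all _ fun η => ?_)
          simp only
          rw [gaussK_eq (hc0 θ) hs.1, hA h hh θ s η hs.2]
          ring
        rw [this]; ring
      obtain ⟨g', hg', hgA'⟩ := hu.aop hm (fun θ => (hc θ).1)
      refine ⟨g', hg', fun θ t x ht => ?_⟩
      have e1 : (fun z => G θ n t z) = fun z => Gk (c θ) (T - t) (z - y θ) * 
          ∑ h ∈ Finset.Icc 1 n, α h θ * S h θ (T - t) (z - y θ) := funext (e θ t ht)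
      have hA' : Aop (fun z => G θ n t z) x = Aop (fun z => Gk (c θ) (T - t) z * 
          ∑ h ∈ Finset.Icc 1 n, α h θ * S h θ (T - t) z) (x - y θ) := by
        rw [e1]
        exact Aop_shift (fun z => Gk (c θ) (T - t) z * 
          ∑ h ∈ Finset.Icc 1 n, α h θ * S h θ (T - t) z) (y θ) x
      refine ⟨?_, ?_, ?_⟩
      · rw [e1]
        exact ((contDiff_Gk (c θ) (T - t)).mul (hu.smooth θ (T - t))).comp
          (contDiff_id.sub (contDiff_const (c := y θ)))
      · rw [hA', hgA' θ (T-t) _ (by linarith)]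
      · have hd := ((hEu θ).pde (T - t) (x - y θ) (sub_pos.2 ht)).comp_const_sub T t
        have hd' := hd.congr_of_eventuallyEq (f₁ := fun s => G θ n s x) (by
          filter_upwards [gt_mem_nhds ht] with s hs
          rw [e θ s hs])
        refine hd'.congr_deriv ?_
        rw [hA', neg_add, add_comm, sub_eq_add_neg]
        congr 2
        rw [Finset.mul_sum]
        refine Finset.sum_congr rfl fun h hh => ?_
        rw [hA h hh θ t x ht]
        ring

lemma taylor_bound {a : ℝ → ℝ} {K : ℝ} {n : ℕ} (ha : ContDiff ℝ ((n:ℕ∞) + 1) a) 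
    (hb : ∀ x, |iteratedDeriv (n+1) a x| ≤ K) (x y : ℝ) :
    |(a x - a y) / 2 - ∑ h ∈ Finset.Icc 1 n, iteratedDeriv h a y / (2 * h.factorial) * (x - y)^h|
      ≤ K * |x - y|^(n+1) := by
  have hK : 0 ≤ K := (abs_nonneg _).trans (hb 0)
  rcases eq_or_ne y x with rfl | hne
  · have : ∑ h ∈ Finset.Icc 1 n, iteratedDeriv h a y / (2 * h.factorial) * (y - y)^h = 0 := by
      refine Finset.sum_eq_zero fun h hh => ?_
      rw [Finset.mem_Icc] at hh
      rw [sub_self, zero_pow (by omega), mul_zero]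
    rw [this]; simp
  · have ha' : ContDiff ℝ (n+1) a := by exact_mod_cast ha
    obtain ⟨x', -, e⟩ := taylor_mean_remainder_lagrange_iteratedDeriv hne ha'.contDiffOn
    rw [taylor_within_apply, Finset.sum_range_succ'] at e
    have e2 : ∑ h ∈ Finset.Icc 1 n, iteratedDeriv h a y / (2 * h.factorial) * (x - y)^h
      = (∑ k ∈ Finset.range n, (((k+1).factorial : ℝ)⁻¹ * (x - y) ^ (k+1)) •
          iteratedDerivWithin (k+1) a (uIcc y x) y) / 2 := by
      rw [Finset.sum_div]
      symm
      refine Finset.sum_nbij' (fun k => k + 1) (fun h => h - 1) ?_ ?_ ?_ ?_ ?_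
      · intro k hk; simp at hk ⊢; omega
      · intro k hk; simp at hk ⊢; omega
      · intro k hk; simp
      · intro k hk; simp at hk ⊢; omega
      · intro k hk
        rw [iteratedDerivWithin_eq_iteratedDeriv (uniqueDiffOn_uIcc hne) _ left_mem_uIcc]
        · simp only [smul_eq_mul]
          field_simp
        · refine (ha'.of_le ?_).contDiffAt
          rw [Finset.mem_range] at hk
          exact_mod_cast (by omega : k + 1 ≤ n + 1)
    rw [e2]
    simp only [Nat.factorial_zero, Nat.cast_one, inv_one, pow_zero, mul_one, one_smul,
      iteratedDerivWithin_zero] at e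
    have e3 : ∀ s : ℝ, a x - (s + a y) =
        iteratedDeriv (n + 1) a x' * (x - y) ^ (n + 1) / ((n + 1).factorial : ℝ) →
        (a x - a y) / 2 - s / 2 = iteratedDeriv (n + 1) a x' * (x - y) ^ (n + 1) *
          (1 / (2 * ((n + 1).factorial : ℝ))) := by
      intro s hs
      have : (a x - a y) / 2 - s / 2 = (a x - (s + a y)) / 2 := by ring
      rw [this, hs]; field_simp
    rw [e3 _ e, abs_mul, abs_mul, abs_pow]
    have hf : (1:ℝ) ≤ ((n+1).factorial : ℝ) := by exact_mod_cast Nat.factorial_pos _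
    have h1 : |1 / (2 * ((n + 1).factorial : ℝ))| ≤ 1 := by
      rw [abs_of_pos (by positivity), div_le_one (by positivity)]
      linarith
    calc _ ≤ K * |x - y|^(n+1) * 1 := by
          gcongr
          exact hb x'
      _ = _ := mul_one _

/-- The hypotheses on the coefficient `a`. -/
def HypA (N : ℕ) (m M K : ℝ) (a : ℝ → ℝ) : Prop :=
  ContDiff ℝ ((N : ℕ∞) + 1) a ∧ (∀ x : ℝ, m ≤ a x / 2 ∧ a x / 2 ≤ M) ∧
  (∀ k ≤ N + 1, (∀ x : ℝ, |iteratedDeriv k a x| ≤ K) ∧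
          LipschitzWith (Real.toNNReal K) (iteratedDeriv k a))

/-- The hypotheses on the functions `G`. -/
def HypG (T : ℝ) (N : ℕ) (a : ℝ → ℝ) (G : ℕ → ℝ → ℝ → ℝ → ℝ) : Prop :=
  (∀ t x y : ℝ, t < T → G 0 t x y = gaussK (a y) t x T y) ∧
  (∀ n, 1 ≤ n → n ≤ N → ∀ t x y : ℝ, t < T →
          G n t x y = ∑ h ∈ Finset.Icc 1 n,
            (iteratedDeriv h a y / (2 * h.factorial)) *
              ∫ s in t..T, ∫ η : ℝ, gaussK (a y) t x s η * (η - y)^h *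
                (iteratedDeriv 2 (fun z => G (n - h) s z y) η
                  - deriv (fun z => G (n - h) s z y) η))

lemma sum_swap (N : ℕ) (F : ℕ → ℕ → ℝ) :
    ∑ k ∈ Finset.range (N+1), ∑ h ∈ Finset.Icc 1 k, F h (k - h) =
    ∑ j ∈ Finset.range (N+1), ∑ h ∈ Finset.Icc 1 (N - j), F h j := by
  rw [Finset.sum_sigma', Finset.sum_sigma']
  refine Finset.sum_nbij' (fun p => ⟨p.1 - p.2, p.2⟩) (fun p => ⟨p.1 + p.2, p.2⟩) ?_ ?_ ?_ ?_ ?_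
  · rintro ⟨k, h⟩ hk; simp at hk ⊢; omega
  · rintro ⟨k, h⟩ hk; simp at hk ⊢; omega
  · rintro ⟨k, h⟩ hk; simp at hk ⊢; omega
  · rintro ⟨k, h⟩ hk; simp
  · rintro ⟨k, h⟩ hk; simp

lemma Z0_bound (T : ℝ) (N : ℕ) (m M K ε τ : ℝ) (hm : 0 < m) (hmM : m ≤ M) (hK : 0 < K)
    (hε : 0 < ε) (hτ : 0 < τ) :
    ∃ C, 0 ≤ C ∧ ∀ a G, HypA N m M K a → HypG T N a G → ∀ t x y : ℝ, t < T → T - t ≤ τ →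
      |(a x / 2) *
              (iteratedDeriv 2 (fun z => ∑ k ∈ Finset.range (N + 1), G k t z y) x
                - deriv (fun z => ∑ k ∈ Finset.range (N + 1), G k t z y) x)
            + deriv (fun u => ∑ k ∈ Finset.range (N + 1), G k u x y) t|
      ≤ C * (T - t)^(((N:ℝ) - 1) / 2) * gd (2 * (M + ε) * (T - t)) (x - y) := by
  let Θ : Type := {p : (ℝ → ℝ) × (ℕ → ℝ → ℝ → ℝ → ℝ) × ℝ // HypA N m M K p.1 ∧ HypG T N p.1 p.2.1}
  let c : Θ → ℝ := fun θ => θ.1.1 θ.1.2.2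
  let α : ℕ → Θ → ℝ := fun h θ => iteratedDeriv h θ.1.1 θ.1.2.2 / (2 * h.factorial)
  have hc : ∀ θ, 2 * m ≤ c θ ∧ c θ ≤ 2 * M := fun θ => by
    have := θ.2.1.2.1 θ.1.2.2
    constructor <;> simp only [c] <;> linarith [this.1, this.2]
  have hα : ∀ h ≤ N, ∀ θ, |α h θ| ≤ K := fun h hh θ => by
    have h1 := (θ.2.1.2.2 h (by omega)).1 θ.1.2.2
    have hf : (1:ℝ) ≤ (h.factorial : ℝ) := by exact_mod_cast Nat.factorial_pos _
    simp only [α]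
    rw [abs_div, abs_of_pos (show (0:ℝ) < 2 * h.factorial by positivity)]
    exact (div_le_self (abs_nonneg _) (by linarith)).trans h1
  have rep := G_rep (T := T) hm hc N α hα (fun θ => θ.1.2.2) (fun θ n t x => θ.1.2.1 n t x θ.1.2.2)
    (fun θ t x ht => θ.2.2.1 t x θ.1.2.2 ht)
    (fun θ n h1 h2 t x ht => θ.2.2.2 n h1 h2 t x θ.1.2.2 ht)
  choose! g hg hrep using rep
  have hb : ∀ j, j ≤ N → ∃ C, 0 ≤ C ∧ ∀ θ s ζ, 0 < s → s ≤ τ →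
      |Gk (c θ) s ζ * (ζ^(N-j+1) * g j θ s ζ)| ≤
        C * s^((N - 1 : ℝ)/2) * gd (2 * (M + ε) * s) ζ := by
    intro j hj
    have h1 := ((hg j hj).mul_pow (N-j+1)).bound hm hmM hε hτ hc
    have hw : (j:ℤ) - 2 + (N - j + 1 : ℕ) = (N:ℤ) - 1 := by omega
    rw [hw] at h1
    push_cast at h1
    exact h1
  choose! C hC0 hCb using hb
  refine ⟨∑ j ∈ Finset.range (N+1), K * C j, Finset.sum_nonneg fun j hj =>
    mul_nonneg hK.le (hC0 j (by simp at hj; omega)), ?_⟩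
  intro a G ha hG t x y ht htτ
  let θ : Θ := ⟨(a, G, y), ha, hG⟩
  have hr : ∀ k ∈ Finset.range (N+1), _ := fun k hk => 
    hrep k (by simp at hk; omega) θ t x ht
  have hD := (HasDerivAt.fun_sum fun k hk => (hr k hk).2.2).deriv
  have hA := Aop_sum (Finset.range (N+1)) (fun k z => G k t z y) (fun k hk => (hr k hk).1) x
  simp only [θ] at hD
  rw [hD]
  change |a x / 2 * Aop (fun z => ∑ k ∈ Finset.range (N + 1), G k t z y) x + _| ≤ _
  rw [hA, Finset.sum_sub_distrib,
    sum_swap N (fun h j => α h θ * (x - y)^h * Aop (fun z => G j t z y) x), Finset.mul_sum,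
    ← add_sub_assoc, ← Finset.sum_add_distrib, ← Finset.sum_sub_distrib, Finset.sum_mul,
    Finset.sum_mul]
  refine (Finset.abs_sum_le_sum_abs _ _).trans (Finset.sum_le_sum fun j hj => ?_)
  have hjN : j ≤ N := by simp at hj; omega
  have hT := taylor_bound (n := N - j) (K := K) (ha.1.of_le (by
    exact_mod_cast (by omega : N - j + 1 ≤ N + 1))) (ha.2.2 (N - j + 1) (by omega)).1 x y
  have hAj : Aop (fun z => G j t z y) x = Gk (a y) (T - t) (x - y) * g j θ (T - t) (x - y) :=
    (hr j hj).2.1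
  have hbj : |Gk (a y) (T-t) (x-y) * ((x-y)^(N-j+1) * g j θ (T-t) (x-y))| ≤
        C j * (T-t)^((N - 1 : ℝ)/2) * gd (2 * (M + ε) * (T-t)) (x-y) :=
    hCb j hjN θ (T - t) (x - y) (sub_pos.2 ht) htτ
  calc _ = |((a x - a y) / 2 - ∑ h ∈ Finset.Icc 1 (N-j),
          iteratedDeriv h a y / (2 * h.factorial) * (x - y)^h) * Aop (fun z => G j t z y) x| := by
        congr 1
        rw [← Finset.sum_mul]
        simp only [c, α, θ]
        ring
    _ ≤ K * |x - y|^(N-j+1) * |Gk (a y) (T - t) (x - y) * g j θ (T - t) (x - y)| := by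
        rw [abs_mul, hAj]
        exact mul_le_mul_of_nonneg_right hT (abs_nonneg _)
    _ = K * |Gk (a y) (T-t) (x-y) * ((x-y)^(N-j+1) * g j θ (T-t) (x-y))| := by
        simp only [abs_mul, abs_pow]; ring
    _ ≤ K * (C j * (T-t)^((N - 1 : ℝ)/2) * gd (2 * (M + ε) * (T-t)) (x-y)) :=
        mul_le_mul_of_nonneg_left hbj hK.le
    _ = _ := by ring

lemma LG0_bound (N : ℕ) (m M K ε τ : ℝ) (hm : 0 < m) (hmM : m ≤ M) (hK : 0 < K)
    (hε : 0 < ε) (hτ : 0 < τ) :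
    ∃ C, 0 ≤ C ∧ ∀ a, HypA N m M K a → ∀ t x s η : ℝ, t < s → s - t ≤ τ →
      |LG0 a t x s η| ≤ C * (s - t)^(-(1:ℝ)/2) * gd (2 * (M + ε) * (s - t)) (x - η) := by
  let Θ : Type := {c : ℝ // 2 * m ≤ c ∧ c ≤ 2 * M}
  have hu : InV (Θ := Θ) (0:ℤ) (fun θ τ ζ => 1 * τ^(0:ℤ) * ζ^0) :=
        InV.mono (fun _ => 1) 1 (by simp) 0 0 (by simp)
  obtain ⟨g, hg, hgA⟩ := hu.aop (c := fun θ : Θ => θ.1) hm (fun θ => θ.2.1)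
  obtain ⟨C, hC, hb⟩ := (hg.mul_pow 1).bound (c := fun θ : Θ => θ.1) hm hmM hε hτ (fun θ => θ.2)
  refine ⟨K * C, by positivity, ?_⟩
  intro a ha t x s η hts hsτ
  have haη := ha.2.1 η
  have hc0 : 0 < a η := by linarith
  let θ : Θ := ⟨a η, by linarith, by linarith⟩
  have hs := sub_pos.2 hts
  have e1 : (fun z => gaussK (a η) t z s η) = fun z => Gk (a η) (s - t) (z - η) := 
    funext fun z => gaussK_eq hc0 hts z η
  have hA0 : Aop (Gk (a η) (s-t)) (x - η) = Gk (a η) (s - t) (x - η) * g θ (s - t) (x - η) := by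
    have := hgA θ (s - t) (x - η) hs
    simpa using this
  have hA1 : Aop (Gk (a η) (s-t)) (x - η) = Gk (a η) (s - t) (x - η) * 
      (-1/4 - 1 / (a η*(s - t)) + (x - η)^2/(a η*(s - t))^2) := by
    have := Aop_mono hc0 hs 1 0 (x - η)
    simpa using this
  have hA : Aop (fun z => gaussK (a η) t z s η) x = Aop (Gk (a η) (s-t)) (x - η) := by
    rw [e1]; exact Aop_shift (Gk (a η) (s-t)) η x
  have hd : deriv (fun u => gaussK (a η) u x s η) t = - (a η / 2 * Aop (Gk (a η) (s-t)) (x - η)) := by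
    have hd := (hasDerivAt_Gk_t hc0 hs (x - η)).comp_const_sub s t
    have hd' := hd.congr_of_eventuallyEq (f₁ := fun u => gaussK (a η) u x s η) (by
          filter_upwards [gt_mem_nhds hts] with u hu
          rw [gaussK_eq hc0 hu])
    rw [hd'.deriv, hA1]
    field_simp
    ring
  have e : LG0 a t x s η = (a x - a η) / 2 * (Gk (a η) (s - t) (x - η) * g θ (s - t) (x - η)) := by
    unfold LG0
    rw [hd]
    change a x / 2 * Aop (fun z => gaussK (a η) t z s η) x + _ = _
    rw [hA, ← hA0]; ring
  have hT := taylor_bound (n := 0) (K := K) (ha.1.of_le (by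
    exact_mod_cast (by omega : 0 + 1 ≤ N + 1))) (ha.2.2 1 (by omega)).1 x η
  simp only [Finset.Icc_eq_empty_of_lt (zero_lt_one), Finset.sum_empty, sub_zero, zero_add,
    pow_one] at hT
  have hbb := hb θ (s - t) (x - η) hs hsτ
  calc _ ≤ K * |x - η| * |Gk (a η) (s - t) (x - η) * g θ (s - t) (x - η)| := by
        rw [e, abs_mul]
        exact mul_le_mul_of_nonneg_right hT (abs_nonneg _)
    _ = K * |Gk (a η) (s - t) (x - η) * ((x - η)^1 * g θ (s - t) (x - η))| := by
        simp only [abs_mul, abs_pow]; ring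
    _ ≤ K * _ := mul_le_mul_of_nonneg_left hbb hK.le
    _ = _ := by norm_num; ring

lemma beta_real {b : ℝ} (hb : 0 < b) :
    IntervalIntegrable (fun x : ℝ => x^(-(1:ℝ)/2) * (1 - x)^(b - 1)) volume 0 1 ∧
    ∫ x in (0:ℝ)..1, x^(-(1:ℝ)/2) * (1 - x)^(b - 1) =
      Real.Gamma (1/2) * Real.Gamma b / Real.Gamma (1/2 + b) := by
  have h0 := Complex.betaIntegral_convergent (u := ((1/2 : ℝ) : ℂ)) (v := (b:ℂ)) (by simp) (by simpa)
  have e : ∀ x ∈ Ioc (0:ℝ) 1, (x:ℂ)^(((1/2 : ℝ) : ℂ) - 1) * (1 - (x:ℂ))^((b:ℂ) - 1) =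
      ((x^(-(1:ℝ)/2) * (1 - x)^(b - 1) : ℝ) : ℂ) := by
    intro x hx
    have : (-(1:ℝ)/2) = 1/2 - 1 := by norm_num
    rw [this]
    push_cast
    rw [Complex.ofReal_cpow hx.1.le, Complex.ofReal_cpow (by linarith [hx.2])]
    push_cast
    rfl
  have h1 : IntervalIntegrable (fun x : ℝ => ((x^(-(1:ℝ)/2) * (1 - x)^(b - 1) : ℝ) : ℂ)) volume 0 1 := 
    h0.congr fun x hx => by
      rw [uIoc_of_le zero_le_one] at hx
      exact e x hx
  have h2 : IntervalIntegrable (fun x : ℝ => x^(-(1:ℝ)/2) * (1 - x)^(b - 1)) volume 0 1 := by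
    rw [intervalIntegrable_iff] at h1 ⊢
    exact h1.re
  refine ⟨h2, ?_⟩
  have h3 := ProbabilityTheory.beta_eq_betaIntegralReal (1/2) b (by norm_num) hb
  rw [ProbabilityTheory.beta] at h3
  rw [h3, Complex.betaIntegral, intervalIntegral.integral_of_le zero_le_one,
    intervalIntegral.integral_of_le zero_le_one, setIntegral_congr_fun measurableSet_Ioc e,
    integral_complex_ofReal, Complex.ofReal_re]

lemma beta_scaled {b t T : ℝ} (hb : 0 < b) (htT : t < T) :
    IntervalIntegrable (fun s : ℝ => (s - t)^(-(1:ℝ)/2) * (T - s)^(b - 1)) volume t T ∧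
    ∫ s in t..T, (s - t)^(-(1:ℝ)/2) * (T - s)^(b - 1) =
      (T - t)^(b - 1/2) * (Real.Gamma (1/2) * Real.Gamma b / Real.Gamma (1/2 + b)) := by
  obtain ⟨h1, h2⟩ := beta_real hb
  have hτ : 0 < T - t := sub_pos.2 htT
  set τ := T - t with hτd
  have e : ∀ s ∈ Ioo t T, τ^(b - 3/2) * ((s / τ - t / τ)^(-(1:ℝ)/2) * (1 - (s / τ - t / τ))^(b - 1))
      = (s - t)^(-(1:ℝ)/2) * (T - s)^(b - 1) := by
    intro s hs
    have e1 : s / τ - t / τ = (s - t) / τ := by ring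
    have e2 : 1 - (s / τ - t / τ) = (T - s) / τ := by rw [e1]; field_simp; rw [hτd]; ring
    rw [e2, e1, Real.div_rpow (by linarith [hs.1]) hτ.le, Real.div_rpow (by linarith [hs.2]) hτ.le]
    have : τ^(b - 3/2) = τ^(-(1:ℝ)/2) * τ^(b - 1) := by
      rw [← Real.rpow_add hτ]; congr 1; ring
    rw [this]
    field_simp
  have ends : t / τ - t / τ = 0 ∧ T / τ - t / τ = 1 := by
    constructor
    · ring
    · rw [← sub_div, ← hτd, div_self hτ.ne']
  constructor
  · have i1 := (h1.comp_sub_right (t / τ)).comp_mul_right (c := τ⁻¹) 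
    have i2 := i1.const_mul (τ^(b - 3/2))
    have a1 : (0 + t / τ) / τ⁻¹ = t := by field_simp; ring
    have a2 : (1 + t / τ) / τ⁻¹ = T := by field_simp; rw [hτd]; ring
    rw [a1, a2] at i2
    refine i2.congr_uIoo fun s hs => ?_
    rw [uIoo_of_le htT.le] at hs
    rw [← e s hs]
    simp only [div_eq_mul_inv]
  · rw [← integral_congr_Ioo_of_le htT.le e, intervalIntegral.integral_const_mul]
    have := intervalIntegral.integral_comp_div_sub (a := t) (b := T)
      (fun x : ℝ => x^(-(1:ℝ)/2) * (1 - x)^(b - 1)) hτ.ne' (t / τ)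
    rw [this, ends.1, ends.2, h2, smul_eq_mul, ← mul_assoc]
    congr 1
    nth_rewrite 2 [← Real.rpow_one τ]
    rw [← Real.rpow_add hτ]; congr 1; ring

/-- **Key estimate of the parametrix iteration for the adjoint expansion** (purely
diffusive, time-homogeneous, `r = 0`, basepoint `x̄ = y`): the iterated parametrix terms
`Z^N_n` satisfy
`|Z^N_n(t,x;T,y)| ≤ C^{n+1} (Γ_E((1+N)/2)/Γ_E((n+1+N)/2)) (T-t)^{(N+n-1)/2} Γ̄^{M+ε}(t,x;T,y)`
for a constant `C` depending only on `ε, τ, m, M, N` and the bounds on `a` and its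
derivatives. -/
theorem parametrix_iteration_estimate
    (T : ℝ) (hT : 0 < T) (N : ℕ)
    (m M K ε τ : ℝ) (hm : 0 < m) (hmM : m ≤ M) (hK : 0 < K)
    (hε : 0 < ε) (hτ : 0 < τ) :
    ∃ C > (0:ℝ),
      ∀ a : ℝ → ℝ,
        ContDiff ℝ ((N : ℕ∞) + 1) a →
        (∀ x : ℝ, m ≤ a x / 2 ∧ a x / 2 ≤ M) →
        (∀ k ≤ N + 1, (∀ x : ℝ, |iteratedDeriv k a x| ≤ K) ∧
          LipschitzWith (Real.toNNReal K) (iteratedDeriv k a)) →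
      ∀ G : ℕ → ℝ → ℝ → ℝ → ℝ,   -- `G n t x y = Gⁿ(t,x;T,y)` with basepoint `x̄ = y`
        (∀ t x y : ℝ, t < T → G 0 t x y = gaussK (a y) t x T y) →
        (∀ n, 1 ≤ n → n ≤ N → ∀ t x y : ℝ, t < T →
          G n t x y = ∑ h ∈ Finset.Icc 1 n,
            (iteratedDeriv h a y / (2 * h.factorial)) *
              ∫ s in t..T, ∫ η : ℝ, gaussK (a y) t x s η * (η - y)^h *
                (iteratedDeriv 2 (fun z => G (n - h) s z y) η
                  - deriv (fun z => G (n - h) s z y) η)) →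
      ∀ Z : ℕ → ℝ → ℝ → ℝ → ℝ,   -- `Z n t x y = Z^N_n(t,x;T,y)`
        -- `Z₀^N = L Γ^N`, where `Γ^N = Σ_{k=0}^N G^k` and `L = (a(x)/2)(∂_{xx}-∂_x) + ∂_t`
        (∀ t x y : ℝ, t < T →
          Z 0 t x y = (a x / 2) *
              (iteratedDeriv 2 (fun z => ∑ k ∈ Finset.range (N + 1), G k t z y) x
                - deriv (fun z => ∑ k ∈ Finset.range (N + 1), G k t z y) x)
            + deriv (fun u => ∑ k ∈ Finset.range (N + 1), G k u x y) t) →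
        -- `Z^N_{n+1}(t,x;T,y) = ∫_t^T ∫ L G⁰_η(t,x;s,η) Z^N_n(s,η;T,y) dη ds`
        (∀ n : ℕ, ∀ t x y : ℝ, t < T →
          Z (n + 1) t x y = ∫ s in t..T, ∫ η : ℝ, LG0 a t x s η * Z n s η y) →
      ∀ n : ℕ, ∀ x y t : ℝ, 0 < T - t → T - t ≤ τ →
        |Z n t x y| ≤ C^(n + 1) *
            (Real.Gamma ((1 + N) / 2) / Real.Gamma ((n + 1 + N) / 2)) *
            (T - t) ^ (((N : ℝ) + n - 1) / 2) * heatKer (M + ε) t x T y := by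
  obtain ⟨C0, hC0, hZ0⟩ := Z0_bound T N m M K ε τ hm hmM hK hε hτ
  obtain ⟨C1, hC1, hLG⟩ := LG0_bound N m M K ε τ hm hmM hK hε hτ
  have hΓ2 : 0 < Real.Gamma (1/2) := Real.Gamma_pos_of_pos (by norm_num)
  have hMε : 0 < M + ε := by linarith
  have hCpos : 0 < C0 + C1 * Real.Gamma (1/2) + 1 := by positivity
  refine ⟨C0 + C1 * Real.Gamma (1/2) + 1, hCpos, ?_⟩
  set C := C0 + C1 * Real.Gamma (1/2) + 1 with hCdef
  have hCC0 : C0 ≤ C := by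
    have : 0 ≤ C1 * Real.Gamma (1/2) := by positivity
    linarith
  have hCC1 : C1 * Real.Gamma (1/2) ≤ C := by linarith
  intro a ha1 ha2 ha3 G hG0 hGn Z hZ0' hZn n
  have hA : HypA N m M K a := ⟨ha1, ha2, ha3⟩
  have hG : HypG T N a G := ⟨hG0, hGn⟩
  induction n with
  | zero =>
    intro x y t ht htτ
    have hg : 0 < Real.Gamma ((1 + (N:ℝ)) / 2) := Real.Gamma_pos_of_pos (by positivity)
    have h := hZ0 a G hA hG t x y (by linarith) htτ
    rw [← hZ0' t x y (by linarith)] at h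
    rw [heatKer_eq]
    refine h.trans ?_
    have e1 : Real.Gamma ((1 + (N:ℝ)) / 2) / Real.Gamma ((((0:ℕ):ℝ) + 1 + N) / 2) = 1 := by
      rw [Nat.cast_zero, zero_add, div_self hg.ne']
    have e2 : ((N:ℝ) + ((0:ℕ):ℝ) - 1) / 2 = ((N:ℝ) - 1) / 2 := by simp
    rw [e1, e2, zero_add, pow_one, mul_one]
    have := gd_nonneg (2 * (M + ε) * (T - t)) (x - y)
    gcongr
  | succ n ih =>
    intro x y t ht htτ
    have htT : t < T := by linarith
    rw [hZn n t x y htT, heatKer_eq]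
    set b : ℝ := ((n:ℝ) + 1 + N) / 2 with hb
    have hbpos : 0 < b := by positivity
    have hgN : 0 < Real.Gamma ((1 + (N:ℝ)) / 2) := Real.Gamma_pos_of_pos (by positivity)
    have hgb : 0 < Real.Gamma b := Real.Gamma_pos_of_pos hbpos
    have hgb' : 0 < Real.Gamma (1/2 + b) := Real.Gamma_pos_of_pos (by positivity)
    obtain ⟨hI, hE⟩ := beta_scaled hbpos htT
    set κ : ℝ := C^(n+1) * (Real.Gamma ((1 + (N:ℝ)) / 2) / Real.Gamma b) with hκ
    have hκ0 : 0 ≤ κ := by positivity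
    set g : ℝ := gd (2 * (M + ε) * (T - t)) (x - y) with hgd
    have hg0 : 0 ≤ g := gd_nonneg _ _
    have hin : ∀ s ∈ Ioo t T, ‖∫ η : ℝ, LG0 a t x s η * Z n s η y‖ ≤
        (C1 * κ * g) * ((s - t)^(-(1:ℝ)/2) * (T - s)^(b - 1)) := by
      rintro s ⟨hs1, hs2⟩
      have hv : 0 < 2 * (M + ε) * (s - t) := by have := sub_pos.2 hs1; positivity
      have hw : 0 < 2 * (M + ε) * (T - s) := by have := sub_pos.2 hs2; positivity
      have hbd := norm_integral_le_of_norm_le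
        ((heat_conv_integrable hv hw x y).const_mul
          ((C1 * (s - t)^(-(1:ℝ)/2)) * (κ * (T - s)^(b - 1))))
        (f := fun η => LG0 a t x s η * Z n s η y) (Eventually.of_forall fun η => by
          have h1 := hLG a hA t x s η hs1 (by linarith)
          have h2 := ih η y s (by linarith) (by linarith)
          have e2 : ((N:ℝ) + n - 1) / 2 = b - 1 := by rw [hb]; ring
          rw [heatKer_eq, e2] at h2
          rw [Real.norm_eq_abs, abs_mul]
          refine (mul_le_mul h1 h2 (abs_nonneg _) ((abs_nonneg _).trans h1)).trans (le_of_eq ?_)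
          ring)
      refine hbd.trans (le_of_eq ?_)
      rw [MeasureTheory.integral_const_mul, heat_conv hv hw]
      have e3 : 2 * (M + ε) * (s - t) + 2 * (M + ε) * (T - s) = 2 * (M + ε) * (T - t) := by ring
      rw [e3]; ring
    have hout : |∫ s in t..T, ∫ η : ℝ, LG0 a t x s η * Z n s η y| ≤
        ∫ s in t..T, (C1 * κ * g) * ((s - t)^(-(1:ℝ)/2) * (T - s)^(b - 1)) := by
      rw [← Real.norm_eq_abs]
      refine intervalIntegral.norm_integral_le_of_norm_le htT.le ?_ (hI.const_mul _)
      have hne : ∀ᵐ s : ℝ, s ≠ T := by simp [ae_iff]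
      filter_upwards [hne] with s hs hst
      exact hin s ⟨hst.1, lt_of_le_of_ne hst.2 hs⟩
    rw [intervalIntegral.integral_const_mul, hE] at hout
    refine hout.trans ?_
    have e4 : ((N:ℝ) + ((n + 1 : ℕ):ℝ) - 1) / 2 = b - 1/2 := by rw [hb]; push_cast; ring
    have e5 : (((n + 1 : ℕ):ℝ) + 1 + N) / 2 = 1/2 + b := by rw [hb]; push_cast; ring
    rw [e4, e5]
    have e6 : C1 * κ * g * ((T - t)^(b - 1/2) *
        (Real.Gamma (1/2) * Real.Gamma b / Real.Gamma (1/2 + b))) =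
        (C1 * Real.Gamma (1/2)) * (C^(n+1) * (Real.Gamma ((1 + (N:ℝ)) / 2) /
          Real.Gamma (1/2 + b)) * (T - t)^(b - 1/2) * g) := by
      rw [hκ]; field_simp
    rw [e6]
    refine (mul_le_mul_of_nonneg_right hCC1 (by positivity)).trans (le_of_eq ?_)
    rw [pow_succ C (n+1)]; ring

end
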